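/- arXiv:1801.00953 — 2 statements merged into one kernel-verified Lean document; each statement's English description precedes it below -/
import Mathlib

section
/- Let q be a real number with q > 1 and [k] := (q^k - q^{-k})/(q - q^{-1}). For integers m, n ≥ 0 and i ≥ 1, with α_t := [2t][t+1][t-1]/([2t+2][t]^2) and β_t := [t-1]/([t][2]), the coefficient A_i := -[6][2]/[3] + α_{m+i} + α_{n+i} + ([6][2]/[3])(β_{n+i} + β_{m+i}) - [4][2] β_{n+i} β_{m+i} is strictly negative. (This is the generic-q version of the key estimate: the coefficients in the recursive evaluation of the theta net all have the same sign.) -/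
/-- Quantum integer `[k] = (q^k - q^{-k})/(q - q^{-1})` for a real parameter `q`. -/
noncomputable def qi (q : ℝ) (k : ℤ) : ℝ := (q ^ k - q ^ (-k)) / (q - q⁻¹)

/-- The coefficient `α_t = [2t][t+1][t-1]/([2t+2][t]^2)`. -/
noncomputable def alpha (q : ℝ) (t : ℤ) : ℝ :=
  qi q (2 * t) * qi q (t + 1) * qi q (t - 1) / (qi q (2 * t + 2) * (qi q t) ^ 2)

/-- The coefficient `β_t = [t-1]/([t][2])`. -/
noncomputable def beta (q : ℝ) (t : ℤ) : ℝ :=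
  qi q (t - 1) / (qi q t * qi q 2)

/-- The coefficient
`A_i = -[6][2]/[3] + α_{m+i} + α_{n+i} + ([6][2]/[3])(β_{n+i}+β_{m+i}) - [4][2]β_{n+i}β_{m+i}`
from Kim's double-clasp expansion in the recursive evaluation of the theta net. -/
noncomputable def coeffA (q : ℝ) (m n : ℕ) (i : ℕ) : ℝ :=
  -(qi q 6 * qi q 2) / qi q 3 + alpha q ((m : ℤ) + i) + alpha q ((n : ℤ) + i)
    + (qi q 6 * qi q 2 / qi q 3) * (beta q ((n : ℤ) + i) + beta q ((m : ℤ) + i))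
    - qi q 4 * qi q 2 * (beta q ((n : ℤ) + i) * beta q ((m : ℤ) + i))

/-- `[2] = (q² + 1)/q`. -/
theorem qi_two {q : ℝ} (hq : 1 < q) : qi q 2 = (q ^ 2 + 1) / q := by
  have h0 : q ≠ 0 := by positivity
  have h1 : q ^ 2 - 1 ≠ 0 := by nlinarith
  have e : qi q 2 = (q ^ 2 - (q ^ 2)⁻¹) / (q - q⁻¹) := by
    unfold qi; rw [zpow_neg]; norm_cast
  rw [e]
  field_simp
  ring

/-- `[6]/[3] = q³ + q⁻³`. -/
theorem qi_six_div_qi_three {q : ℝ} (hq : 1 < q) :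
    qi q 6 / qi q 3 = (q ^ 6 + 1) / q ^ 3 := by
  have h0 : q ≠ 0 := by positivity
  have h1 : q ^ 2 - 1 ≠ 0 := by nlinarith
  have h3 : q ^ 6 - 1 ≠ 0 := by
    have := one_lt_pow₀ hq (n := 6) (by norm_num)
    linarith
  have e6 : qi q 6 = (q ^ 6 - (q ^ 6)⁻¹) / (q - q⁻¹) := by
    unfold qi; rw [zpow_neg]; norm_cast
  have e3 : qi q 3 = (q ^ 3 - (q ^ 3)⁻¹) / (q - q⁻¹) := by
    unfold qi; rw [zpow_neg]; norm_cast
  rw [e6, e3]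
  field_simp
  ring

/-- `[4] = [2] (q² + q⁻²)`. -/
theorem qi_four {q : ℝ} (hq : 1 < q) :
    qi q 4 = (q ^ 2 + 1) * (q ^ 4 + 1) / q ^ 3 := by
  have h0 : q ≠ 0 := by positivity
  have h1 : q ^ 2 - 1 ≠ 0 := by nlinarith
  have e : qi q 4 = (q ^ 4 - (q ^ 4)⁻¹) / (q - q⁻¹) := by
    unfold qi; rw [zpow_neg]; norm_cast
  rw [e]
  field_simp
  ring

/-- In terms of `w = q [t-1]/[t] ∈ [0, 1]`, `β_t` is linear and `α_t` has a quadratic upper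
bound. -/
theorem exists_beta_eq_alpha_le {q : ℝ} (hq : 1 < q) {t : ℤ} (ht : 1 ≤ t) :
    ∃ w : ℝ, 0 ≤ w ∧ w ≤ 1 ∧ beta q t = w / (q ^ 2 + 1) ∧
      alpha q t ≤ w * (1 / q ^ 2 + (1 - w) / q ^ 4) := by
  have h0 : q ≠ 0 := by positivity
  have hs : 0 < q ^ 2 - 1 := by nlinarith
  have hqX : q ≤ q ^ t := by simpa using zpow_le_zpow_right₀ hq.le ht
  have e1 : qi q t = (q ^ t - (q ^ t)⁻¹) / (q - q⁻¹) := by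
    rw [qi, zpow_neg]
  have e2 : qi q (t - 1) = (q ^ t / q - (q ^ t / q)⁻¹) / (q - q⁻¹) := by
    rw [qi, zpow_neg, zpow_sub₀ h0, zpow_one]
  have e3 : qi q (t + 1) = (q ^ t * q - (q ^ t * q)⁻¹) / (q - q⁻¹) := by
    rw [qi, zpow_neg, zpow_add₀ h0, zpow_one]
  have e4 : qi q (2 * t) = ((q ^ t) ^ 2 - ((q ^ t) ^ 2)⁻¹) / (q - q⁻¹) := by
    rw [qi, zpow_neg, mul_comm, zpow_mul]; norm_cast
  have e5 : qi q (2 * t + 2) =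
      ((q ^ t * q) ^ 2 - ((q ^ t * q) ^ 2)⁻¹) / (q - q⁻¹) := by
    rw [qi, zpow_neg, show 2 * t + 2 = (t + 1) * 2 by ring, zpow_mul, zpow_add₀ h0, zpow_one]
    norm_cast
  rw [alpha, beta, e1, e2, e3, e4, e5, qi_two hq]
  generalize q ^ t = X at hqX
  have hX0 : X ≠ 0 := (by linarith : 0 < X).ne'
  have hX : 0 < X ^ 2 - 1 := by nlinarith
  have hXq : 0 ≤ X ^ 2 - q ^ 2 := by nlinarith
  have hY : 0 < X ^ 2 * q ^ 2 - 1 := by nlinarith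
  have hZ : X ^ 4 * q ^ 4 - 1 ≠ 0 := by
    have : 0 < (X ^ 2 * q ^ 2 - 1) * (X ^ 2 * q ^ 2 + 1) := by positivity
    nlinarith
  have hw : 0 ≤ (X ^ 2 - q ^ 2) / (X ^ 2 - 1) := by positivity
  refine ⟨(X ^ 2 - q ^ 2) / (X ^ 2 - 1), hw, ?_, ?_, ?_⟩
  · rw [div_le_one hX]; linarith
  · have := hX.ne'
    have := hs.ne'
    field_simp
  · have ha : (X ^ 2 - (X ^ 2)⁻¹) / (q - q⁻¹) * ((X * q - (X * q)⁻¹) / (q - q⁻¹)) *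
        ((X / q - (X / q)⁻¹) / (q - q⁻¹)) /
        (((X * q) ^ 2 - ((X * q) ^ 2)⁻¹) / (q - q⁻¹) * ((X - X⁻¹) / (q - q⁻¹)) ^ 2) =
        (X ^ 2 - q ^ 2) / (X ^ 2 - 1) * ((X ^ 2 + 1) / (q ^ 2 * X ^ 2 + 1)) := by
      have := hX.ne'
      have := hs.ne'
      field_simp
      ring
    rw [ha]
    refine mul_le_mul_of_nonneg_left ?_ hw
    have hd : 1 / q ^ 2 + (1 - (X ^ 2 - q ^ 2) / (X ^ 2 - 1)) / q ^ 4 -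
        (X ^ 2 + 1) / (q ^ 2 * X ^ 2 + 1) =
        (q ^ 2 - 1) * (q ^ 2 + 1) / (q ^ 4 * (X ^ 2 - 1) * (q ^ 2 * X ^ 2 + 1)) := by
      have := hX.ne'
      field_simp
      ring
    rw [← sub_nonneg, hd]
    positivity

/-- The generic-`q` version of the key estimate: the coefficient `A_i` is strictly
negative for every real `q > 1`. -/
theorem coeffA_neg_generic (q : ℝ) (hq : 1 < q) (m n i : ℕ) (hi : 1 ≤ i) :
    coeffA q m n i < 0 := by
  obtain ⟨v, hv0, hv1, hbm, ham⟩ := exists_beta_eq_alpha_le hq (t := (m : ℤ) + i) (by omega)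
  obtain ⟨w, hw0, hw1, hbn, han⟩ := exists_beta_eq_alpha_le hq (t := (n : ℤ) + i) (by omega)
  have h0 : q ≠ 0 := by positivity
  have hs : 0 < q ^ 2 - 1 := by nlinarith
  have hK : qi q 6 * qi q 2 / qi q 3 = (q ^ 2 + 1) * (q ^ 6 + 1) / q ^ 4 := by
    rw [mul_div_right_comm, qi_six_div_qi_three hq, qi_two hq]
    field_simp
  have hL : qi q 4 * qi q 2 = (q ^ 2 + 1) ^ 2 * (q ^ 4 + 1) / q ^ 4 := by
    rw [qi_four hq, qi_two hq]
    field_simp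
  rw [coeffA, neg_div, hK, hL, hbm, hbn]
  have hsum : -((q ^ 2 + 1) * (q ^ 6 + 1) / q ^ 4) + v * (1 / q ^ 2 + (1 - v) / q ^ 4)
      + w * (1 / q ^ 2 + (1 - w) / q ^ 4)
      + (q ^ 2 + 1) * (q ^ 6 + 1) / q ^ 4 * (w / (q ^ 2 + 1) + v / (q ^ 2 + 1))
      - (q ^ 2 + 1) ^ 2 * (q ^ 4 + 1) / q ^ 4 * (w / (q ^ 2 + 1) * (v / (q ^ 2 + 1)))
      = -(((q ^ 2 - 1) * q ^ 2 * (q ^ 4 + 1) + (q ^ 2 - 1) * (q ^ 4 + 1) * ((1 - v) + (1 - w))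
        + (1 - v) ^ 2 + (1 - w) ^ 2 + (q ^ 4 + 1) * ((1 - v) * (1 - w))) / q ^ 4) := by
    field_simp
    ring
  have hv : 0 ≤ 1 - v := by linarith
  have hw : 0 ≤ 1 - w := by linarith
  have hpos : 0 < ((q ^ 2 - 1) * q ^ 2 * (q ^ 4 + 1)
      + (q ^ 2 - 1) * (q ^ 4 + 1) * ((1 - v) + (1 - w))
      + (1 - v) ^ 2 + (1 - w) ^ 2 + (q ^ 4 + 1) * ((1 - v) * (1 - w))) / q ^ 4 := by
    positivity
  linarith
end

section
/- Let q be a real number with q > 1 and [k] := (q^k - q^{-k})/(q - q^{-1}). For integers m, n ≥ 0, with α_t := [2t][t+1][t-1]/([2t+2][t]^2), β_t := [t-1]/([t][2]), A_i := -[6][2]/[3] + α_{m+i} + α_{n+i} + ([6][2]/[3])(β_{n+i} + β_{m+i}) - [4][2] β_{n+i} β_{m+i}, and B_k := α_{n+k} α_{m+k}, define Θ(m,n,p) recursively by Θ(m,n,0) := [2(m+n)+4][m+n+3][m+n+1]/([4][3]) and Θ(m,n,p) := ( A_p + Σ_{i=1}^{p-1} A_i · ∏_{k=i+1}^{p} B_k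 ) · Θ(m,n,p-1) for p ≥ 1. Then Θ(m,n,p) ≠ 0 for every integer p ≥ 0. (This is the generic-q nonvanishing of the theta net θ((m+p,0),(m+n,0),(n+p,0)), which shows that for generic q the space Hom(V_{(a,0)} ⊗ V_{(b,0)} ⊗ V_{(c,0)}, ℂ) is exactly one-dimensional for admissible triples.) -/
/-- The coefficient `B_k = α_{n+k} α_{m+k}`. -/
noncomputable def coeffB (q : ℝ) (m n : ℕ) (k : ℕ) : ℝ :=
  alpha q ((n : ℤ) + k) * alpha q ((m : ℤ) + k)

/-- The recursively defined value `Θ(m,n,p)` of the theta net (up to sign):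
`Θ(m,n,0) = [2(m+n)+4][m+n+3][m+n+1]/([4][3])` and
`Θ(m,n,p) = (A_p + Σ_{i=1}^{p-1} A_i ∏_{k=i+1}^p B_k)·Θ(m,n,p-1)`. -/
noncomputable def Theta (q : ℝ) (m n : ℕ) : ℕ → ℝ
  | 0 => qi q (2 * ((m : ℤ) + n) + 4) * qi q ((m : ℤ) + n + 3) * qi q ((m : ℤ) + n + 1)
      / (qi q 4 * qi q 3)
  | p + 1 =>
      (coeffA q m n (p + 1) + ∑ i ∈ Finset.Icc 1 p,
          coeffA q m n i * ∏ k ∈ Finset.Icc (i + 1) (p + 1), coeffB q m n k)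
        * Theta q m n p

theorem qi_pos {q : ℝ} (hq : 1 < q) {k : ℤ} (hk : 0 < k) : 0 < qi q k := by
  have hinv : q⁻¹ < 1 := inv_lt_one_of_one_lt₀ hq
  have hlt : q ^ (-k) < q ^ k := zpow_lt_zpow_right₀ hq (by omega)
  exact div_pos (by linarith) (by linarith)

theorem qi_nonneg {q : ℝ} (hq : 1 < q) {k : ℤ} (hk : 0 ≤ k) : 0 ≤ qi q k := by
  rcases hk.eq_or_lt with rfl | hk
  · simp [qi]
  · exact (qi_pos hq hk).le

theorem qi_two_mul {q : ℝ} (hq : 1 < q) (k : ℤ) :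
    qi q (2 * k) = qi q k * (q ^ k + q ^ (-k)) := by
  have h0 : q ≠ 0 := by positivity
  have h1 : q ^ (2 * k) = q ^ k * q ^ k := by rw [← zpow_add₀ h0]; ring_nf
  have h2 : q ^ (-(2 * k)) = q ^ (-k) * q ^ (-k) := by rw [← zpow_add₀ h0]; ring_nf
  simp only [qi, h1, h2]
  ring

theorem alpha_nonneg {q : ℝ} (hq : 1 < q) {t : ℤ} (ht : 1 ≤ t) : 0 ≤ alpha q t := by
  have h1 := qi_nonneg hq (k := 2 * t) (by omega)
  have h2 := qi_nonneg hq (k := t + 1) (by omega)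
  have h3 := qi_nonneg hq (k := t - 1) (by omega)
  have h4 := qi_nonneg hq (k := 2 * t + 2) (by omega)
  unfold alpha
  positivity

theorem zpow_add_zpow_neg_le_succ {q : ℝ} (hq : 1 < q) {t : ℤ} (ht : 0 ≤ t) :
    q ^ t + q ^ (-t) ≤ q ^ (t + 1) + q ^ (-(t + 1)) := by
  have h0 : q ≠ 0 := by positivity
  have hx : 1 ≤ q ^ t := one_le_zpow₀ hq.le ht
  have hy : q ^ (-(t + 1)) ≤ 1 := zpow_le_one_of_nonpos₀ hq.le (by omega)
  have h1 : q ^ (t + 1) = q ^ t * q := zpow_add_one₀ h0 t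
  have h2 : q ^ (-t) = q ^ (-(t + 1)) * q := by rw [← zpow_add_one₀ h0]; ring_nf
  rw [h1, h2]
  nlinarith [mul_nonneg (sub_nonneg.2 hq.le) (sub_nonneg.2 (hy.trans hx))]

theorem alpha_le {q : ℝ} (hq : 1 < q) {t : ℤ} (ht : 1 ≤ t) :
    alpha q t ≤ qi q (t - 1) / qi q t := by
  have h1 := qi_pos hq (k := t) (by omega)
  have h2 := qi_pos hq (k := t + 1) (by omega)
  have h3 := qi_nonneg hq (k := t - 1) (by omega)
  have h4 : 0 < q ^ (t + 1) + q ^ (-(t + 1)) := by positivity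
  have h5 := zpow_add_zpow_neg_le_succ hq (t := t) (by omega)
  have h6 : alpha q t = (q ^ t + q ^ (-t)) / (q ^ (t + 1) + q ^ (-(t + 1))) *
      (qi q (t - 1) / qi q t) := by
    rw [alpha, show 2 * t + 2 = 2 * (t + 1) by ring, qi_two_mul hq, qi_two_mul hq]
    field_simp
  rw [h6]
  exact mul_le_of_le_one_left (by positivity) ((div_le_one h4).2 h5)

theorem qi_pred_div_le_inv {q : ℝ} (hq : 1 < q) {t : ℤ} (ht : 1 ≤ t) :
    qi q (t - 1) / qi q t ≤ q⁻¹ := by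
  have h0 : q ≠ 0 := by positivity
  have hinv : q⁻¹ < 1 := inv_lt_one_of_one_lt₀ hq
  rw [div_le_iff₀ (qi_pos hq (by omega)), qi, qi, ← mul_div_assoc]
  refine div_le_div_of_nonneg_right ?_ (by linarith)
  have h1 : q ^ (t - 1) = q⁻¹ * q ^ t := by rw [zpow_sub_one₀ h0, mul_comm]
  have h2 : q⁻¹ * q ^ (-t) ≤ q ^ (-(t - 1)) := by
    rw [mul_comm, ← zpow_sub_one₀ h0]
    exact zpow_le_zpow_right₀ hq.le (by omega)
  rw [h1]
  linarith

theorem bilinear_bound_neg {q r s : ℝ} (hq : 1 < q) (hr : r ≤ q⁻¹) (hs : s ≤ q⁻¹) :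
    -((q ^ 3 + q⁻¹ ^ 3) * (q + q⁻¹)) + (1 + q ^ 3 + q⁻¹ ^ 3) * (r + s)
      - (q ^ 2 + q⁻¹ ^ 2) * (r * s) < 0 := by
  have hu0 : 0 < q⁻¹ := by positivity
  have hu1 : q⁻¹ < 1 := inv_lt_one_of_one_lt₀ hq
  have hqu : q * q⁻¹ = 1 := mul_inv_cancel₀ (by positivity)
  generalize q⁻¹ = u at *
  have hk : ∀ x ≤ u, 0 ≤ 1 + q ^ 3 + u ^ 3 - (q ^ 2 + u ^ 2) * x := by
    intro x hx
    have h1 : (q ^ 2 + u ^ 2) * x ≤ (q ^ 2 + u ^ 2) * u := by gcongr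
    have h2 : (q ^ 2 + u ^ 2) * u = q + u ^ 3 := by linear_combination q * hqu
    have h3 : q ≤ q ^ 3 := le_self_pow₀ hq.le (by norm_num)
    linarith
  have h1 := mul_nonneg (sub_nonneg.2 hr) (hk s hs)
  have h2 := mul_nonneg (sub_nonneg.2 hs) (hk u le_rfl)
  have h3 : -((q ^ 3 + u ^ 3) * (q + u)) + (1 + q ^ 3 + u ^ 3) * (u + u)
      - (q ^ 2 + u ^ 2) * (u * u) = -((q ^ 2 - 1) * (q ^ 2 + u ^ 2)) + 2 * (u - u ^ 2) := by
    linear_combination (q ^ 2 - u ^ 2) * hqu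
  have h4 : u - u ^ 2 < q - 1 := by nlinarith
  have h5 : 2 ≤ q ^ 2 + u ^ 2 := by nlinarith [sq_nonneg (q - u)]
  have h6 : q - 1 ≤ q ^ 2 - 1 := by nlinarith
  have h7 : (q ^ 2 - 1) * 2 ≤ (q ^ 2 - 1) * (q ^ 2 + u ^ 2) :=
    mul_le_mul_of_nonneg_left h5 (by linarith)
  linarith

theorem coeffA_neg {q : ℝ} (hq : 1 < q) (m n : ℕ) {i : ℕ} (hi : 1 ≤ i) :
    coeffA q m n i < 0 := by
  have hm : (1 : ℤ) ≤ m + i := by omega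
  have hn : (1 : ℤ) ≤ n + i := by omega
  have h1 : qi q 1 = 1 := by
    have : q⁻¹ < 1 := inv_lt_one_of_one_lt₀ hq
    simp only [qi, zpow_one, zpow_neg_one]
    exact div_self (by linarith)
  have h2 : qi q 2 = q + q⁻¹ := by simpa [h1] using qi_two_mul hq 1
  have h3 := qi_pos hq (k := 3) (by norm_num)
  have h4 : qi q 4 = qi q 2 * (q ^ 2 + q⁻¹ ^ 2) := by
    simpa [zpow_neg, zpow_ofNat] using qi_two_mul hq 2
  have h6 : qi q 6 = qi q 3 * (q ^ 3 + q⁻¹ ^ 3) := by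
    simpa [zpow_neg, zpow_ofNat] using qi_two_mul hq 3
  have hp := qi_pos hq (k := 2) (by norm_num)
  have hpos_m := qi_pos hq (k := m + i) (by omega)
  have hpos_n := qi_pos hq (k := n + i) (by omega)
  have key := bilinear_bound_neg hq (qi_pred_div_le_inv hq hm) (qi_pred_div_le_inv hq hn)
  have hA : coeffA q m n i = -((q ^ 3 + q⁻¹ ^ 3) * (q + q⁻¹)) + alpha q (m + i) + alpha q (n + i)
      + (q ^ 3 + q⁻¹ ^ 3) * (qi q (m + i - 1) / qi q (m + i) + qi q (n + i - 1) / qi q (n + i))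
      - (q ^ 2 + q⁻¹ ^ 2) *
        (qi q (m + i - 1) / qi q (m + i) * (qi q (n + i - 1) / qi q (n + i))) := by
    rw [coeffA, beta, beta, h4, h6, ← h2]
    generalize q ^ 3 + q⁻¹ ^ 3 = a
    generalize q ^ 2 + q⁻¹ ^ 2 = b
    field_simp
    ring
  rw [hA]
  linarith [alpha_le hq hm, alpha_le hq hn]

theorem coeffB_nonneg {q : ℝ} (hq : 1 < q) (m n : ℕ) {k : ℕ} (hk : 1 ≤ k) :
    0 ≤ coeffB q m n k :=
  mul_nonneg (alpha_nonneg hq (by omega)) (alpha_nonneg hq (by omega))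

/-- Generic-`q` nonvanishing of the theta net `θ((m+p,0),(m+n,0),(n+p,0))`. -/
theorem theta_ne_zero_generic (q : ℝ) (hq : 1 < q) (m n : ℕ) :
    ∀ p : ℕ, Theta q m n p ≠ 0 := by
  intro p
  induction p with
  | zero =>
    have h1 := qi_pos hq (k := 2 * ((m : ℤ) + n) + 4) (by omega)
    have h2 := qi_pos hq (k := (m : ℤ) + n + 3) (by omega)
    have h3 := qi_pos hq (k := (m : ℤ) + n + 1) (by omega)
    have h4 := qi_pos hq (k := 4) (by norm_num)
    have h5 := qi_pos hq (k := 3) (by norm_num)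
    rw [Theta]
    positivity
  | succ p ih =>
    rw [Theta]
    refine mul_ne_zero (ne_of_lt ?_) ih
    refine add_neg_of_neg_of_nonpos (coeffA_neg hq m n (by omega)) ?_
    refine Finset.sum_nonpos fun i hi => mul_nonpos_of_nonpos_of_nonneg
      (coeffA_neg hq m n (Finset.mem_Icc.1 hi).1).le (Finset.prod_nonneg fun k hk => ?_)
    exact coeffB_nonneg hq m n (by have := (Finset.mem_Icc.1 hk).1; omega)
end
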